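/- Let n ≥ 4 and a₁, a₂ > 0. There exist R₀ ≥ 8 and constants C₁, C₂ > 0, depending only on n, a₁ and a₂, with the following property. Let R ≥ R₀, λ ∈ [R, R+2], Γ ≥ 1, T > 0 and ρ with 4λ ≤ ρ ≤ Γ; set Σ_λ = (B(0,ρ) ∩ {y ∈ ℝⁿ : yₙ > −T}) ∖ cl(B(0,λ)), Ω_λ = {y ∈ Σ_λ : |y| ≤ 2λ and y₁ > 2·|(y₂,…,yₙ)|}, and e = (1,0,…,0). Let Q : Σ_λ → ℝ be continuous and satisfy: Q(η) ≤ −a₁·Γ^{−1}·(|η|−λ)·(1+|η−λe|²)^{−(n+2)/2} for η ∈ Ω_λ; |Q(η)| ≤ a₂·Γ^{−1}·(|η|−λ) for η ∈ Ω_λ; and |Q(η)| ≤ a₂·Γ^{−1}·(|η|−λ)·|η|^{−n−2} for η ∈ Σ_λ ∖ Ω_λ. Define h(y) = ∫_{Σ_λ} G_λ(y,η)·Q(η) dη. Then for all y ∈ Σ_λ: if |y| ≤ 4λ then h(y) ≤ −C₁·Γ^{−1}·(|y|−λ)·λ^{−n}·log λ and |h(y)| ≤ C₂·Γ^{−1}·(|y|−λ)·λ²;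 and if |y| ≥ 4λ then h(y) ≤ −C₁·Γ^{−1}·|y|^{2−n}·λ^{−1}·log λ and |h(y)| ≤ C₂·Γ^{−1}·|y|^{2−n}·λ^{n+1}. -/

import Mathlib

open Metric Set MeasureTheory

noncomputable section

abbrev Euc (n : ℕ) := EuclideanSpace ℝ (Fin n)

/-- Index of the last coordinate. -/
def lastIdx (n : ℕ) (h0 : 0 < n) : Fin n := ⟨n - 1, by omega⟩

/-- The inverted point `y^λ = λ²y/|y|²`. -/
def invPt {n : ℕ} (lam : ℝ) (y : Euc n) : Euc n := (lam ^ 2 / ‖y‖ ^ 2) • y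

/-- Surface measure `σₙ` of the unit sphere in `ℝⁿ` (equal to `n·vol(Bⁿ)`). -/
def sphereArea (n : ℕ) : ℝ :=
  (n : ℝ) * (volume (Metric.ball (0 : Euc n) 1)).toReal

/-- The Dirichlet Green's function of `-Δ` on `ℝⁿ ∖ cl(B(0,λ))`. -/
def greenG (n : ℕ) (lam : ℝ) (y η : Euc n) : ℝ :=
  (1 / (((n : ℝ) - 2) * sphereArea n)) *
    (‖y - η‖ ^ ((2 : ℝ) - (n : ℝ))
      - (‖y‖ / lam) ^ ((2 : ℝ) - (n : ℝ)) * ‖invPt lam y - η‖ ^ ((2 : ℝ) - (n : ℝ)))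

/-- Euclidean norm of the last `n - 1` coordinates `|(y₂, …, yₙ)|`. -/
def tailNorm (n : ℕ) (h0 : 0 < n) (y : Euc n) : ℝ :=
  Real.sqrt (∑ i ∈ Finset.univ.erase (⟨0, h0⟩ : Fin n), (y i) ^ 2)

/-- The domain `Σ_λ = (B(0,ρ) ∩ {yₙ > -T}) ∖ cl(B(0,λ))`. -/
def SigSet (n : ℕ) (h0 : 0 < n) (lam ρ T : ℝ) : Set (Euc n) :=
  (Metric.ball (0 : Euc n) ρ ∩ {y | -T < y (lastIdx n h0)}) \ Metric.closedBall (0 : Euc n) lam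

/-- The cone region `Ω_λ ⊆ Σ_λ`. -/
def OmegaSet (n : ℕ) (h0 : 0 < n) (lam ρ T : ℝ) : Set (Euc n) :=
  {y ∈ SigSet n h0 lam ρ T | ‖y‖ ≤ 2 * lam ∧ 2 * tailNorm n h0 y < y (⟨0, h0⟩ : Fin n)}

/-- Tangent line inequality for the convex function `x ↦ x ^ (-p / 2)` at squared arguments. -/
lemma rpow_neg_sub_rpow_neg_le {p s t : ℝ} (hp : 0 ≤ p) (hs : 0 < s) (ht : 0 < t) :
    t ^ (-p) - s ^ (-p) ≤ p / 2 * ((s ^ 2 - t ^ 2) / t ^ 2) * t ^ (-p) := by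
  have h1 : s ^ (-p) = (s / t) ^ (-p) * t ^ (-p) := by
    rw [← Real.mul_rpow (by positivity) ht.le, div_mul_cancel₀ _ ht.ne']
  have h2 : 1 - p / 2 * ((s ^ 2 - t ^ 2) / t ^ 2) ≤ (s / t) ^ (-p) := by
    have hst : 0 < s / t := by positivity
    rw [Real.rpow_def_of_pos hst]
    have h3 := Real.add_one_le_exp (Real.log (s / t) * -p)
    have h4 := Real.log_le_sub_one_of_pos (show 0 < (s / t) ^ 2 by positivity)
    rw [Real.log_pow] at h4
    have h5 : (s ^ 2 - t ^ 2) / t ^ 2 = (s / t) ^ 2 - 1 := by field_simp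
    rw [h5]
    push_cast at h4
    nlinarith
  have h6 : 0 < t ^ (-p) := Real.rpow_pos_of_pos ht _
  rw [h1]
  nlinarith

lemma sphereArea_pos {n : ℕ} (hn : 0 < n) : 0 < sphereArea n := by
  have : 0 < (volume (Metric.ball (0 : Euc n) 1)).toReal :=
    ENNReal.toReal_pos (Metric.measure_ball_pos _ _ one_pos).ne' measure_ball_lt_top.ne
  unfold sphereArea
  positivity

lemma sq_norm_invPt_sub {n : ℕ} {lam : ℝ} (hl : 0 < lam) {y : Euc n} (hy : 0 < ‖y‖) (η : Euc n) :
    (‖y‖ / lam * ‖invPt lam y - η‖) ^ 2 =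
      ‖y - η‖ ^ 2 + (‖y‖ ^ 2 - lam ^ 2) * (‖η‖ ^ 2 - lam ^ 2) / lam ^ 2 := by
  rw [mul_pow, norm_sub_sq_real, norm_sub_sq_real, invPt, real_inner_smul_left, norm_smul,
    Real.norm_of_nonneg (by positivity)]
  field_simp
  ring

lemma norm_sub_le_norm_invPt_sub {n : ℕ} {lam : ℝ} (hl : 0 < lam) {y η : Euc n} (hy : lam < ‖y‖)
    (hη : lam < ‖η‖) : ‖y - η‖ ≤ ‖y‖ / lam * ‖invPt lam y - η‖ := by
  have h := sq_norm_invPt_sub hl (hl.trans hy) η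
  have hD : 0 < (‖y‖ ^ 2 - lam ^ 2) * (‖η‖ ^ 2 - lam ^ 2) / lam ^ 2 := by
    have : 0 < ‖y‖ ^ 2 - lam ^ 2 := by nlinarith
    have : 0 < ‖η‖ ^ 2 - lam ^ 2 := by nlinarith
    positivity
  exact le_of_sq_le_sq (by linarith) (by positivity)

lemma greenG_eq {n : ℕ} {lam : ℝ} (hl : 0 < lam) (y η : Euc n) :
    greenG n lam y η = 1 / (((n : ℝ) - 2) * sphereArea n) *
      (‖y - η‖ ^ (-((n : ℝ) - 2)) - (‖y‖ / lam * ‖invPt lam y - η‖) ^ (-((n : ℝ) - 2))) := by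
  rw [greenG, Real.mul_rpow (by positivity) (norm_nonneg _), neg_sub]

lemma greenG_le {n : ℕ} (hn : 3 ≤ n) {lam : ℝ} (hl : 0 < lam) (y η : Euc n) :
    greenG n lam y η ≤ 1 / (((n : ℝ) - 2) * sphereArea n) * ‖y - η‖ ^ (-((n : ℝ) - 2)) := by
  have hn' : (3 : ℝ) ≤ n := by exact_mod_cast hn
  have h1 := sphereArea_pos (n := n) (by omega)
  have h2 : 0 < (n : ℝ) - 2 := by linarith
  rw [greenG_eq hl]
  gcongr
  simp only [sub_le_self_iff]
  positivity

/-- Lower bound for the Green function, sharp in the distances to the sphere. -/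
lemma le_greenG {n : ℕ} (hn : 3 ≤ n) {lam : ℝ} (hl : 0 < lam) {y η : Euc n} (hy : lam < ‖y‖)
    (hη : lam < ‖η‖) (hne : y ≠ η) (hη2 : ‖η‖ ≤ 2 * lam) :
    1 / (2 * sphereArea n) * (3 : ℝ) ^ (-(n : ℝ)) * min 1 ((‖y‖ - lam) / lam) *
        ‖y‖ ^ (-((n : ℝ) - 2)) * lam⁻¹ * (‖η‖ - lam) ≤ greenG n lam y η := by
  have hn' : (3 : ℝ) ≤ n := by exact_mod_cast hn
  have h1 := sphereArea_pos (n := n) (by omega)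
  have h2 : 0 < (n : ℝ) - 2 := by linarith
  have hy0 : 0 < ‖y‖ := hl.trans hy
  have hs : 0 < ‖y - η‖ := norm_pos_iff.2 (sub_ne_zero.2 hne)
  set u := ‖y‖ / lam * ‖invPt lam y - η‖ with hu
  have hu2 := sq_norm_invPt_sub hl hy0 η
  rw [← hu] at hu2
  have hu0 : 0 < u := hs.trans_le (norm_sub_le_norm_invPt_sub hl hy hη)
  have hu3 : u ≤ 3 * ‖y‖ := by
    have e1 : ‖invPt lam y‖ = lam ^ 2 / ‖y‖ := by
      rw [invPt, norm_smul, Real.norm_of_nonneg (by positivity)]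
      field_simp
    have e2 := norm_sub_le (invPt lam y) η
    calc u ≤ ‖y‖ / lam * (lam ^ 2 / ‖y‖ + 2 * lam) := by
          rw [hu]; gcongr; linarith
      _ = lam + 2 * ‖y‖ := by field_simp
      _ ≤ _ := by linarith
  have key := rpow_neg_sub_rpow_neg_le h2.le hs hu0
  have hun : u ^ (-((n : ℝ) - 2)) / u ^ 2 = u ^ (-(n : ℝ)) := by
    rw [← Real.rpow_natCast u 2, ← Real.rpow_sub hu0]; congr 1; push_cast; ring
  have hyn : ‖y‖ ^ (-((n : ℝ) - 2)) = ‖y‖ ^ (-(n : ℝ)) * ‖y‖ ^ 2 := by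
    rw [← Real.rpow_natCast ‖y‖ 2, ← Real.rpow_add hy0]; congr 1; push_cast; ring
  have hun2 : (3 : ℝ) ^ (-(n : ℝ)) * ‖y‖ ^ (-(n : ℝ)) ≤ u ^ (-(n : ℝ)) := by
    rw [← Real.mul_rpow (by norm_num) hy0.le]
    exact Real.rpow_le_rpow_of_nonpos hu0 hu3 (by linarith)
  have hm : min 1 ((‖y‖ - lam) / lam) * ‖y‖ ≤ 2 * (‖y‖ - lam) := by
    have e1 : min 1 ((‖y‖ - lam) / lam) ≤ 1 := min_le_left _ _
    have e2 : min 1 ((‖y‖ - lam) / lam) * lam ≤ (‖y‖ - lam) := by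
      rw [← le_div_iff₀ hl]; exact min_le_right _ _
    nlinarith
  have hDl : (min 1 ((‖y‖ - lam) / lam) * ‖y‖) * ‖y‖ * (‖η‖ - lam) * lam⁻¹ ≤
      (‖y‖ ^ 2 - lam ^ 2) * (‖η‖ ^ 2 - lam ^ 2) / lam ^ 2 := by
    have e0 : 0 < ‖η‖ - lam := by linarith
    have e0' : 0 < ‖y‖ - lam := by linarith
    calc (min 1 ((‖y‖ - lam) / lam) * ‖y‖) * ‖y‖ * (‖η‖ - lam) * lam⁻¹
        ≤ (2 * (‖y‖ - lam)) * ‖y‖ * (‖η‖ - lam) * lam⁻¹ := by gcongr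
      _ = ((‖y‖ - lam) * ‖y‖) * ((‖η‖ - lam) * (2 * lam)) / lam ^ 2 := by field_simp
      _ ≤ ((‖y‖ - lam) * (‖y‖ + lam)) * ((‖η‖ - lam) * (‖η‖ + lam)) / lam ^ 2 := by
          gcongr <;> linarith
      _ = _ := by ring
  have hm0 : 0 ≤ min 1 ((‖y‖ - lam) / lam) :=
    le_min zero_le_one (div_nonneg (by linarith) hl.le)
  have e0 : 0 < ‖η‖ - lam := by linarith
  rw [greenG_eq hl, ← hu]
  have hfin : ((n : ℝ) - 2) / 2 * ((3 : ℝ) ^ (-(n : ℝ)) * ‖y‖ ^ (-(n : ℝ))) *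
      ((min 1 ((‖y‖ - lam) / lam) * ‖y‖) * ‖y‖ * (‖η‖ - lam) * lam⁻¹) ≤
      ‖y - η‖ ^ (-((n : ℝ) - 2)) - u ^ (-((n : ℝ) - 2)) := by
    calc _ ≤ ((n : ℝ) - 2) / 2 * u ^ (-(n : ℝ)) *
          ((‖y‖ ^ 2 - lam ^ 2) * (‖η‖ ^ 2 - lam ^ 2) / lam ^ 2) := by gcongr
      _ = -(((n : ℝ) - 2) / 2 * ((‖y - η‖ ^ 2 - u ^ 2) / u ^ 2) * u ^ (-((n : ℝ) - 2))) := by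
          rw [← hun, hu2]; ring
      _ ≤ _ := by linarith
  calc _ = 1 / (((n : ℝ) - 2) * sphereArea n) * (((n : ℝ) - 2) / 2 *
      ((3 : ℝ) ^ (-(n : ℝ)) * ‖y‖ ^ (-(n : ℝ))) *
      ((min 1 ((‖y‖ - lam) / lam) * ‖y‖) * ‖y‖ * (‖η‖ - lam) * lam⁻¹)) := by
        rw [hyn]; field_simp
    _ ≤ _ := by gcongr

lemma greenG_nonneg {n : ℕ} (hn : 3 ≤ n) {lam : ℝ} (hl : 0 < lam) {y η : Euc n} (hy : lam < ‖y‖)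
    (hη : lam < ‖η‖) (hne : y ≠ η) : 0 ≤ greenG n lam y η := by
  have hn' : (3 : ℝ) ≤ n := by exact_mod_cast hn
  have h1 := sphereArea_pos (n := n) (by omega)
  have h2 : 0 < (n : ℝ) - 2 := by linarith
  have hs : 0 < ‖y - η‖ := norm_pos_iff.2 (sub_ne_zero.2 hne)
  rw [greenG_eq hl]
  refine mul_nonneg (by positivity) (sub_nonneg.2 ?_)
  exact Real.rpow_le_rpow_of_nonpos hs (norm_sub_le_norm_invPt_sub hl hy hη) (by linarith)

/-- Upper bound for the Green function times the distance of `η` to the sphere. -/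
lemma greenG_mul_le {n : ℕ} (hn : 3 ≤ n) {lam : ℝ} (hl : 0 < lam) {y η : Euc n} (hy : lam < ‖y‖)
    (hη : lam < ‖η‖) (hne : y ≠ η) :
    greenG n lam y η * (‖η‖ - lam) ≤ 12 / sphereArea n *
      min 1 ((‖y‖ - lam) / lam) * ‖y - η‖ ^ (-((n : ℝ) - 2)) * ‖η‖ := by
  have hn' : (3 : ℝ) ≤ n := by exact_mod_cast hn
  have h1 := sphereArea_pos (n := n) (by omega)
  have h2 : 0 < (n : ℝ) - 2 := by linarith
  have hy0 : 0 < ‖y‖ := hl.trans hy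
  have hs : 0 < ‖y - η‖ := norm_pos_iff.2 (sub_ne_zero.2 hne)
  have e0 : 0 < ‖η‖ - lam := by linarith
  have e0' : 0 < ‖y‖ - lam := by linarith
  have hk : 1 / (((n : ℝ) - 2) * sphereArea n) ≤ 1 / sphereArea n := by
    gcongr; nlinarith
  have hG : greenG n lam y η ≤ 1 / sphereArea n * ‖y - η‖ ^ (-((n : ℝ) - 2)) :=
    (greenG_le hn hl y η).trans (by gcongr)
  rcases le_total (lam) (‖y‖ - lam) with hc | hc
  · rw [min_eq_left ((one_le_div hl).2 hc)]
    calc _ ≤ 1 / sphereArea n * ‖y - η‖ ^ (-((n : ℝ) - 2)) * ‖η‖ := by gcongr; linarith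
      _ ≤ 12 / sphereArea n * 1 * ‖y - η‖ ^ (-((n : ℝ) - 2)) * ‖η‖ := by
        rw [mul_one]; gcongr; norm_num
  rw [min_eq_right ((div_le_one hl).2 hc)]
  rcases le_total (‖η‖ - lam) (2 * (‖y‖ - lam)) with hd | hd
  · calc _ ≤ 1 / sphereArea n * ‖y - η‖ ^ (-((n : ℝ) - 2)) * (2 * (‖y‖ - lam)) := by gcongr
      _ = 2 / sphereArea n * ((‖y‖ - lam) / lam) * ‖y - η‖ ^ (-((n : ℝ) - 2)) * lam := by
        field_simp
      _ ≤ _ := by gcongr; norm_num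
  · set u := ‖y‖ / lam * ‖invPt lam y - η‖ with hu
    have hu2 := sq_norm_invPt_sub hl hy0 η
    rw [← hu] at hu2
    have hu0 : 0 < u := hs.trans_le (norm_sub_le_norm_invPt_sub hl hy hη)
    have key := rpow_neg_sub_rpow_neg_le h2.le hu0 hs
    have hse : ‖η‖ - lam ≤ 2 * ‖y - η‖ := by
      have := norm_sub_norm_le η y
      rw [norm_sub_rev] at this
      linarith
    have hDu : (‖y‖ ^ 2 - lam ^ 2) * (‖η‖ ^ 2 - lam ^ 2) / lam ^ 2 ≤
        6 * ((‖y‖ - lam) / lam) * (‖η‖ - lam) * ‖η‖ := by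
      calc _ = ((‖y‖ - lam) * (‖y‖ + lam)) * ((‖η‖ - lam) * (‖η‖ + lam)) / lam ^ 2 := by ring
        _ ≤ ((‖y‖ - lam) * (3 * lam)) * ((‖η‖ - lam) * (2 * ‖η‖)) / lam ^ 2 := by
          gcongr <;> linarith
        _ = _ := by field_simp; ring
    rw [greenG_eq hl, ← hu]
    calc _ ≤ 1 / (((n : ℝ) - 2) * sphereArea n) * (((n : ℝ) - 2) / 2 *
          ((6 * ((‖y‖ - lam) / lam) * (‖η‖ - lam) * ‖η‖) / ‖y - η‖ ^ 2)
            * ‖y - η‖ ^ (-((n : ℝ) - 2))) * (‖η‖ - lam) := by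
          gcongr
          refine key.trans ?_
          gcongr
          linarith
      _ = 3 / sphereArea n * ((‖y‖ - lam) / lam) * ‖y - η‖ ^ (-((n : ℝ) - 2)) * ‖η‖ *
          ((‖η‖ - lam) ^ 2 / ‖y - η‖ ^ 2) := by field_simp; ring
      _ ≤ 3 / sphereArea n * ((‖y‖ - lam) / lam) * ‖y - η‖ ^ (-((n : ℝ) - 2)) * ‖η‖ *
          4 := by
          gcongr
          rw [div_le_iff₀ (by positivity)]
          nlinarith
      _ = _ := by ring

lemma integral_fun_norm_euc {n : ℕ} (hn : 0 < n) (f : ℝ → ℝ) :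
    ∫ x : Euc n, f ‖x‖ = sphereArea n * ∫ t in Ioi (0 : ℝ), t ^ (n - 1) * f t := by
  have : Nonempty (Fin n) := ⟨⟨0, hn⟩⟩
  rw [integral_fun_norm_addHaar]
  simp [sphereArea, Measure.real, mul_assoc]

lemma integrable_fun_norm_euc {n : ℕ} (hn : 0 < n) {f : ℝ → ℝ} :
    Integrable (fun x : Euc n ↦ f ‖x‖) ↔ IntegrableOn (fun t : ℝ ↦ t ^ (n - 1) * f t) (Ioi 0) := by
  have : Nonempty (Fin n) := ⟨⟨0, hn⟩⟩
  rw [integrable_fun_norm_addHaar]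
  simp

lemma pow_mul_indicator_rpow {n : ℕ} (hn : 0 < n) (s : Set ℝ) (a : ℝ) :
    EqOn (fun t : ℝ ↦ t ^ (n - 1) * s.indicator (fun t ↦ t ^ a) t)
      (s.indicator fun t ↦ t ^ ((n : ℝ) - 1 + a)) (Ioi 0) := by
  intro t (ht : 0 < t)
  by_cases h : t ∈ s
  · simp only [indicator_of_mem h]
    rw [← Real.rpow_natCast, ← Real.rpow_add ht, Nat.cast_pred hn]
  · simp [indicator_of_notMem h]

/-- The radial weight `‖x‖ ^ (-(n + 1))` away from a ball. -/
lemma integral_indicator_Ioi_norm {n : ℕ} (hn : 0 < n) {r : ℝ} (hr : 0 < r) :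
    Integrable (fun x : Euc n ↦ (Ioi r).indicator (fun t ↦ t ^ (-(n : ℝ) - 1)) ‖x‖) ∧
    ∫ x : Euc n, (Ioi r).indicator (fun t ↦ t ^ (-(n : ℝ) - 1)) ‖x‖ = sphereArea n * r⁻¹ := by
  have e : (n : ℝ) - 1 + (-(n : ℝ) - 1) = -2 := by ring
  have hs : Ioi (0 : ℝ) ∩ Ioi r = Ioi r := inter_eq_right.2 (Ioi_subset_Ioi hr.le)
  constructor
  · rw [integrable_fun_norm_euc hn,
      integrableOn_congr_fun (pow_mul_indicator_rpow hn _ _) measurableSet_Ioi, e,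
      integrableOn_indicator_iff measurableSet_Ioi, inter_comm, hs]
    exact integrableOn_Ioi_rpow_of_lt (by norm_num) hr
  · rw [integral_fun_norm_euc hn,
      setIntegral_congr_fun measurableSet_Ioi (pow_mul_indicator_rpow hn _ _), e,
      setIntegral_indicator measurableSet_Ioi, hs, integral_Ioi_rpow_of_lt (by norm_num) hr]
    norm_num [Real.rpow_neg_one]

/-- The fundamental solution is integrable on balls around its pole. -/
lemma integral_indicator_Iio_norm_sub {n : ℕ} (hn : 0 < n) {r : ℝ} (hr : 0 < r) (y : Euc n) :
    Integrable (fun x : Euc n ↦ (Iio r).indicator (fun t ↦ t ^ (-((n : ℝ) - 2))) ‖y - x‖) ∧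
    ∫ x : Euc n, (Iio r).indicator (fun t ↦ t ^ (-((n : ℝ) - 2))) ‖y - x‖ =
      sphereArea n * (r ^ 2 / 2) := by
  have e : (n : ℝ) - 1 + (-((n : ℝ) - 2)) = 1 := by ring
  have hs : Ioi (0 : ℝ) ∩ Iio r = Ioo 0 r := rfl
  constructor
  · refine Integrable.comp_sub_left (f := fun x : Euc n ↦
      (Iio r).indicator (fun t ↦ t ^ (-((n : ℝ) - 2))) ‖x‖) ?_ y
    rw [integrable_fun_norm_euc hn,
      integrableOn_congr_fun (pow_mul_indicator_rpow hn _ _) measurableSet_Ioi, e,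
      integrableOn_indicator_iff measurableSet_Iio, inter_comm, hs]
    simp only [Real.rpow_one]
    exact (continuous_id.integrableOn_Icc (a := 0) (b := r)).mono_set Ioo_subset_Icc_self
  · rw [integral_sub_left_eq_self (fun x : Euc n ↦
      (Iio r).indicator (fun t ↦ t ^ (-((n : ℝ) - 2))) ‖x‖) volume y, integral_fun_norm_euc hn,
      setIntegral_congr_fun measurableSet_Ioi (pow_mul_indicator_rpow hn _ _), e,
      setIntegral_indicator measurableSet_Iio, hs, ← integral_Ioc_eq_integral_Ioo,
      ← intervalIntegral.integral_of_le hr.le]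
    simp

/-- The part of the cone `K` in the annulus `a ≤ ‖x‖ < b`. -/
def coneShell {n : ℕ} (K : Set (Euc n)) (a b : ℝ) : Set (Euc n) :=
  K ∩ {x | a ≤ ‖x‖ ∧ ‖x‖ < b}

lemma measurableSet_coneShell {n : ℕ} {K : Set (Euc n)} (hK : MeasurableSet K) (a b : ℝ) :
    MeasurableSet (coneShell K a b) :=
  hK.inter ((measurableSet_le measurable_const measurable_norm).inter
    (measurableSet_lt measurable_norm measurable_const))

lemma volume_coneShell_lt_top {n : ℕ} (K : Set (Euc n)) (a b : ℝ) :
    volume (coneShell K a b) < ⊤ := by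
  refine (measure_mono ?_).trans_lt (measure_ball_lt_top (x := (0 : Euc n)) (r := b))
  rintro x ⟨-, -, hx⟩
  simpa using hx

open scoped Pointwise in
lemma volume_coneShell_smul {n : ℕ} {K : Set (Euc n)} (hK : ∀ t : ℝ, 0 < t → ∀ x ∈ K, t • x ∈ K)
    {t : ℝ} (ht : 0 < t) (a b : ℝ) :
    volume.real (coneShell K (t * a) (t * b)) = t ^ n * volume.real (coneShell K a b) := by
  have h : coneShell K (t * a) (t * b) = t • coneShell K a b := by
    ext x
    rw [mem_smul_set_iff_inv_smul_mem₀ ht.ne']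
    have hx : x ∈ K ↔ t⁻¹ • x ∈ K := by
      refine ⟨hK _ (inv_pos.2 ht) x, fun h ↦ ?_⟩
      simpa [smul_smul, ht.ne'] using hK t ht _ h
    simp only [coneShell, mem_inter_iff, mem_ofPred_eq, ← hx, norm_smul, norm_inv,
      Real.norm_of_nonneg ht.le, inv_mul_lt_iff₀ ht, le_inv_mul_iff₀ ht]
  rw [h, Measure.real, Measure.addHaar_smul]
  simp [abs_of_pos ht, ht.le, Measure.real]

lemma integrableOn_coneShell {n : ℕ} {K : Set (Euc n)} (hKm : MeasurableSet K) {a : ℝ} (ha : 0 < a)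
    (b : ℝ) : IntegrableOn (fun x : Euc n ↦ (‖x‖ ^ n)⁻¹) (coneShell K a b) := by
  refine Measure.integrableOn_of_bounded (M := (a ^ n)⁻¹) (volume_coneShell_lt_top K a b).ne
    (by fun_prop) ?_
  filter_upwards [ae_restrict_mem (measurableSet_coneShell hKm a b)] with x hx
  rw [Real.norm_of_nonneg (by positivity)]
  gcongr
  exact hx.2.1

/-- The integral of `‖x‖ ^ (-n)` over a cone grows linearly in the number of dyadic shells. -/
lemma le_integral_coneShell {n : ℕ} {K : Set (Euc n)} (hKm : MeasurableSet K)
    (hK : ∀ t : ℝ, 0 < t → ∀ x ∈ K, t • x ∈ K) (N : ℕ) :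
    N * ((2 ^ n)⁻¹ * volume.real (coneShell K 1 2)) ≤
      ∫ x in coneShell K 1 (2 ^ N), (‖x‖ ^ n)⁻¹ := by
  induction N with
  | zero =>
    simp only [CharP.cast_eq_zero, zero_mul]
    exact integral_nonneg fun x ↦ by positivity
  | succ N ih =>
    have hu : coneShell K 1 (2 ^ (N + 1)) =
        coneShell K 1 (2 ^ N) ∪ coneShell K (2 ^ N) (2 ^ (N + 1)) := by
      have h1 : (1 : ℝ) ≤ 2 ^ N := one_le_pow₀ (by norm_num)
      have h2 : (2 : ℝ) ^ N ≤ 2 ^ (N + 1) := by gcongr <;> norm_num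
      ext x
      simp only [coneShell, mem_inter_iff, mem_ofPred_eq, mem_union]
      constructor
      · rintro ⟨hx, h3, h4⟩
        rcases lt_or_ge ‖x‖ (2 ^ N) with h | h
        · exact .inl ⟨hx, h3, h⟩
        · exact .inr ⟨hx, h, h4⟩
      · rintro (⟨hx, h3, h4⟩ | ⟨hx, h3, h4⟩)
        · exact ⟨hx, h3, h4.trans_le h2⟩
        · exact ⟨hx, h1.trans h3, h4⟩
    have hd : Disjoint (coneShell K 1 (2 ^ N)) (coneShell K (2 ^ N) (2 ^ (N + 1))) :=
      disjoint_left.2 fun x hx hx' ↦ hx'.2.1.not_gt hx.2.2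
    rw [hu, setIntegral_union hd (measurableSet_coneShell hKm _ _)
      (integrableOn_coneShell hKm one_pos _) (integrableOn_coneShell hKm (by positivity) _)]
    have hv : volume.real (coneShell K (2 ^ N) (2 ^ (N + 1))) =
        (2 ^ N) ^ n * volume.real (coneShell K 1 2) := by
      rw [← volume_coneShell_smul hK (by positivity), mul_one, pow_succ]
    have hstep : (2 ^ n)⁻¹ * volume.real (coneShell K 1 2) ≤
        ∫ x in coneShell K (2 ^ N) (2 ^ (N + 1)), (‖x‖ ^ n)⁻¹ := by
      calc _ = ∫ x in coneShell K (2 ^ N) (2 ^ (N + 1)), (((2 : ℝ) ^ (N + 1)) ^ n)⁻¹ := by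
            rw [setIntegral_const, hv, smul_eq_mul, pow_succ, mul_pow]
            field_simp
        _ ≤ _ := by
            refine setIntegral_mono_on ?_ (integrableOn_coneShell hKm (by positivity) _)
              (measurableSet_coneShell hKm _ _) fun x hx ↦ ?_
            · exact integrableOn_const (volume_coneShell_lt_top _ _ _).ne
            · have h0 : 0 < ‖x‖ := lt_of_lt_of_le (by positivity) hx.2.1
              gcongr
              exact hx.2.2.le
    push_cast
    linarith

/-- The integral of `‖x‖ ^ (-n)` over an open cone diverges logarithmically. -/
lemma exists_log_le_integral_coneShell {n : ℕ} {K : Set (Euc n)} (hKo : IsOpen K)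
    (hK : ∀ t : ℝ, 0 < t → ∀ x ∈ K, t • x ∈ K) {x₀ : Euc n} (hx₀ : x₀ ∈ K) (hx₀' : x₀ ≠ 0) :
    ∃ c : ℝ, 0 < c ∧ ∀ r : ℝ, 4096 ≤ r →
      c * Real.log r ≤ ∫ x in coneShell K 1 (r / 8), (‖x‖ ^ n)⁻¹ := by
  have hpos : 0 < volume.real (coneShell K 1 2) := by
    have ho : IsOpen (K ∩ {x | 1 < ‖x‖ ∧ ‖x‖ < 2}) := by
      refine hKo.inter ((isOpen_lt continuous_const continuous_norm).inter
        (isOpen_lt continuous_norm continuous_const))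
    have hne : (K ∩ {x : Euc n | 1 < ‖x‖ ∧ ‖x‖ < 2}).Nonempty := by
      have h0 : 0 < ‖x₀‖ := norm_pos_iff.2 hx₀'
      refine ⟨(3 / 2 / ‖x₀‖) • x₀, hK _ (by positivity) _ hx₀, ?_⟩
      rw [mem_ofPred_eq, norm_smul, Real.norm_of_nonneg (by positivity), div_mul_cancel₀ _ h0.ne']
      norm_num
    refine ENNReal.toReal_pos (ne_of_gt ?_) (volume_coneShell_lt_top _ _ _).ne
    exact (ho.measure_pos volume hne).trans_le
      (measure_mono (inter_subset_inter_right _ fun x hx ↦ ⟨hx.1.le, hx.2⟩))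
  refine ⟨(2 ^ n)⁻¹ * volume.real (coneShell K 1 2) / 2, by positivity, fun r hr ↦ ?_⟩
  have hr0 : 0 < r := by linarith
  set N := ⌊Real.log (r / 8)⌋₊ with hN
  have h1 : (2 : ℝ) ^ N ≤ r / 8 := by
    have h2 : (N : ℝ) ≤ Real.log (r / 8) :=
      Nat.floor_le (Real.log_nonneg (by linarith))
    calc (2 : ℝ) ^ N ≤ Real.exp 1 ^ N := by
          gcongr; linarith [Real.add_one_le_exp (1 : ℝ)]
      _ = Real.exp N := by rw [← Real.exp_nat_mul, mul_one]
      _ ≤ Real.exp (Real.log (r / 8)) := Real.exp_le_exp.2 h2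
      _ = _ := Real.exp_log (by positivity)
  have h3 : Real.log r / 2 ≤ N := by
    have h4 := (Nat.lt_floor_add_one (Real.log (r / 8))).le
    rw [← hN, Real.log_div hr0.ne' (by norm_num)] at h4
    have h5 : Real.log 4096 ≤ Real.log r := Real.log_le_log (by norm_num) hr
    rw [show (4096 : ℝ) = 2 ^ 12 by norm_num, Real.log_pow] at h5
    rw [show (8 : ℝ) = 2 ^ 3 by norm_num, Real.log_pow] at h4
    have := Real.log_two_gt_d9
    push_cast at h4 h5
    linarith
  calc _ = Real.log r / 2 * ((2 ^ n)⁻¹ * volume.real (coneShell K 1 2)) := by ring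
    _ ≤ N * ((2 ^ n)⁻¹ * volume.real (coneShell K 1 2)) := by gcongr
    _ ≤ _ := le_integral_coneShell hKo.measurableSet hK N
    _ ≤ _ := by
      refine setIntegral_mono_set (integrableOn_coneShell hKo.measurableSet one_pos _)
        (.of_forall fun x ↦ by positivity) (.of_forall fun x hx ↦ ?_)
      exact ⟨hx.1, hx.2.1, hx.2.2.trans_le h1⟩

lemma rpow_div_two (n : ℕ) {r : ℝ} (hr : 0 ≤ r) :
    (r / 2) ^ (-((n : ℝ) - 2)) = 2 ^ n / 4 * r ^ (-((n : ℝ) - 2)) := by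
  have h : (2 : ℝ) ^ (-((n : ℝ) - 2)) = 4 / 2 ^ n := by
    rw [neg_sub, Real.rpow_sub (by norm_num), Real.rpow_natCast]
    norm_num
  rw [Real.div_rpow hr (by norm_num), h]
  field_simp

/-- An integrable majorant for the fundamental solution times `‖η‖ ^ (-(n + 1))` off a ball. -/
lemma exists_majorant_far {n : ℕ} (hn : 3 ≤ n) {lam : ℝ} (hl : 0 < lam) {y : Euc n}
    (hy : lam < ‖y‖) :
    ∃ F : Euc n → ℝ, Integrable F ∧ (∀ η, 0 ≤ F η) ∧
      ∫ η, F η ≤ 2 ^ n * sphereArea n * (‖y‖ ^ (-((n : ℝ) - 2)) * lam⁻¹) ∧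
      ∀ η, lam < ‖η‖ → y ≠ η →
        ‖y - η‖ ^ (-((n : ℝ) - 2)) * ‖η‖ ^ (-(n : ℝ) - 1) ≤ F η := by
  have hn' : (3 : ℝ) ≤ n := by exact_mod_cast hn
  have hy0 : 0 < ‖y‖ := hl.trans hy
  have hS := sphereArea_pos (n := n) (by omega)
  obtain ⟨i1, e1⟩ := integral_indicator_Ioi_norm (n := n) (by omega) hl
  obtain ⟨i2, e2⟩ := integral_indicator_Iio_norm_sub (n := n) (by omega)
    (show 0 < ‖y‖ / 2 by positivity) y
  have g1 : ∀ η : Euc n, 0 ≤ (Ioi lam).indicator (fun t ↦ t ^ (-(n : ℝ) - 1)) ‖η‖ := fun η ↦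
    indicator_nonneg (fun t (ht : lam < t) ↦ Real.rpow_nonneg (hl.trans ht).le _) _
  have g2 : ∀ η : Euc n,
      0 ≤ (Iio (‖y‖ / 2)).indicator (fun t ↦ t ^ (-((n : ℝ) - 2))) ‖y - η‖ := fun η ↦
    indicator_apply_nonneg fun _ ↦ Real.rpow_nonneg (norm_nonneg _) _
  refine ⟨fun η ↦ (‖y‖ / 2) ^ (-((n : ℝ) - 2)) *
      (Ioi lam).indicator (fun t ↦ t ^ (-(n : ℝ) - 1)) ‖η‖ + (‖y‖ / 2) ^ (-(n : ℝ) - 1) *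
      (Iio (‖y‖ / 2)).indicator (fun t ↦ t ^ (-((n : ℝ) - 2))) ‖y - η‖,
    (i1.const_mul _).add (i2.const_mul _), fun η ↦ ?_, ?_, fun η hη hne ↦ ?_⟩
  · have := g1 η
    have := g2 η
    positivity
  · rw [integral_add (i1.const_mul _) (i2.const_mul _), integral_const_mul, integral_const_mul,
      e1, e2]
    have h1 : (‖y‖ / 2) ^ (-(n : ℝ) - 1) = (‖y‖ / 2) ^ (-((n : ℝ) - 2)) * ((‖y‖ / 2) ^ 3)⁻¹ := by
      rw [← Real.rpow_natCast, ← Real.rpow_neg (by positivity), ← Real.rpow_add (by positivity)]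
      congr 1; push_cast; ring
    have h2 : (‖y‖ / 2) ^ (-((n : ℝ) - 2)) = 2 ^ n / 4 * ‖y‖ ^ (-((n : ℝ) - 2)) :=
      rpow_div_two n hy0.le
    have h3 : ‖y‖⁻¹ ≤ lam⁻¹ := by gcongr
    rw [h1, h2]
    calc _ = 2 ^ n / 4 * sphereArea n * ‖y‖ ^ (-((n : ℝ) - 2)) * (lam⁻¹ + ‖y‖⁻¹) := by
          field_simp
      _ ≤ 2 ^ n / 4 * sphereArea n * ‖y‖ ^ (-((n : ℝ) - 2)) * (4 * lam⁻¹) := by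
          gcongr; nlinarith [inv_pos.2 hl]
      _ = _ := by ring
  · have hs : 0 < ‖y - η‖ := norm_pos_iff.2 (sub_ne_zero.2 hne)
    have hη0 : 0 < ‖η‖ := hl.trans hη
    have g1' := g1 η
    have g2' := g2 η
    rcases lt_or_ge ‖y - η‖ (‖y‖ / 2) with h | h
    · beta_reduce
      rw [indicator_of_mem (s := Iio (‖y‖ / 2)) (by exact h)]
      have h4 : ‖y‖ / 2 ≤ ‖η‖ := by linarith [norm_sub_norm_le y η]
      have h5 : ‖η‖ ^ (-(n : ℝ) - 1) ≤ (‖y‖ / 2) ^ (-(n : ℝ) - 1) :=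
        Real.rpow_le_rpow_of_nonpos (by positivity) h4 (by linarith)
      calc _ ≤ ‖y - η‖ ^ (-((n : ℝ) - 2)) * (‖y‖ / 2) ^ (-(n : ℝ) - 1) := by gcongr
        _ ≤ _ := by
          rw [mul_comm]
          exact le_add_of_nonneg_left (by positivity)
    · beta_reduce
      rw [indicator_of_mem (s := Ioi lam) (by exact hη)]
      have h5 : ‖y - η‖ ^ (-((n : ℝ) - 2)) ≤ (‖y‖ / 2) ^ (-((n : ℝ) - 2)) :=
        Real.rpow_le_rpow_of_nonpos (by positivity) h (by linarith)
      calc _ ≤ (‖y‖ / 2) ^ (-((n : ℝ) - 2)) * ‖η‖ ^ (-(n : ℝ) - 1) := by gcongr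
        _ ≤ _ := le_add_of_nonneg_right (by positivity)

/-- An integrable majorant for the fundamental solution times `‖η‖` on a ball. -/
lemma exists_majorant_near {n : ℕ} (hn : 3 ≤ n) {lam : ℝ} (hl : 0 < lam) {y : Euc n}
    (hy : lam < ‖y‖) :
    ∃ F : Euc n → ℝ, Integrable F ∧ (∀ η, 0 ≤ F η) ∧
      ∫ η, F η ≤ 4 ^ n * sphereArea n * (‖y‖ ^ (-((n : ℝ) - 2)) * lam ^ (n + 1)) ∧
      ∀ η, ‖η‖ ≤ 2 * lam → y ≠ η → ‖y - η‖ ^ (-((n : ℝ) - 2)) * ‖η‖ ≤ F η := by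
  have hn' : (3 : ℝ) ≤ n := by exact_mod_cast hn
  have hy0 : 0 < ‖y‖ := hl.trans hy
  have hS := sphereArea_pos (n := n) (by omega)
  obtain ⟨i2, e2⟩ := integral_indicator_Iio_norm_sub (n := n) (by omega)
    (show 0 < ‖y‖ / 2 by positivity) y
  have hvol : volume (closedBall (0 : Euc n) (2 * lam)) < ⊤ := measure_closedBall_lt_top
  have i1 : Integrable ((closedBall (0 : Euc n) (2 * lam)).indicator fun _ ↦ (1 : ℝ)) :=
    (integrable_indicator_iff measurableSet_closedBall).2 (integrableOn_const hvol.ne)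
  have e1 : ∫ η, (closedBall (0 : Euc n) (2 * lam)).indicator (fun _ ↦ (1 : ℝ)) η ≤
      (2 * lam) ^ n * sphereArea n := by
    have hv : volume.real (closedBall (0 : Euc n) (2 * lam)) =
        (2 * lam) ^ n * (volume (ball (0 : Euc n) 1)).toReal := by
      rw [Measure.real, Measure.addHaar_closedBall _ _ (by positivity)]
      simp [hl.le]
    rw [integral_indicator measurableSet_closedBall, setIntegral_const, hv, smul_eq_mul, mul_one]
    gcongr
    exact le_mul_of_one_le_left ENNReal.toReal_nonneg (by linarith)
  have g1 : ∀ η, 0 ≤ (closedBall (0 : Euc n) (2 * lam)).indicator (fun _ ↦ (1 : ℝ)) η := fun η ↦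
    indicator_nonneg (fun _ _ ↦ zero_le_one) _
  have g2 : ∀ η : Euc n,
      0 ≤ (Iio (‖y‖ / 2)).indicator (fun t ↦ t ^ (-((n : ℝ) - 2))) ‖y - η‖ := fun η ↦
    indicator_apply_nonneg fun _ ↦ Real.rpow_nonneg (norm_nonneg _) _
  refine ⟨fun η ↦ 2 * lam * (‖y‖ / 2) ^ (-((n : ℝ) - 2)) *
      (closedBall (0 : Euc n) (2 * lam)).indicator (fun _ ↦ (1 : ℝ)) η +
      2 * lam * (4 * lam / ‖y‖) ^ n *
      (Iio (‖y‖ / 2)).indicator (fun t ↦ t ^ (-((n : ℝ) - 2))) ‖y - η‖,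
    (i1.const_mul _).add (i2.const_mul _), fun η ↦ ?_, ?_, fun η hη hne ↦ ?_⟩
  · have := g1 η
    have := g2 η
    positivity
  · rw [integral_add (i1.const_mul _) (i2.const_mul _), integral_const_mul, integral_const_mul, e2]
    have h2 : (‖y‖ / 2) ^ (-((n : ℝ) - 2)) = 2 ^ n / 4 * ‖y‖ ^ (-((n : ℝ) - 2)) :=
      rpow_div_two n hy0.le
    have h3 : ‖y‖ ^ (-((n : ℝ) - 2)) = ‖y‖ ^ 2 / ‖y‖ ^ n := by
      rw [← Real.rpow_natCast ‖y‖ n, ← Real.rpow_natCast ‖y‖ 2, ← Real.rpow_sub hy0]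
      congr 1; push_cast; ring
    calc _ ≤ 2 * lam * (‖y‖ / 2) ^ (-((n : ℝ) - 2)) * ((2 * lam) ^ n * sphereArea n) +
          2 * lam * (4 * lam / ‖y‖) ^ n * (sphereArea n * ((‖y‖ / 2) ^ 2 / 2)) := by gcongr
      _ = 3 / 4 * (4 ^ n * sphereArea n * (‖y‖ ^ (-((n : ℝ) - 2)) * lam ^ (n + 1))) := by
          rw [h2, h3, show (4 : ℝ) = 2 * 2 by norm_num]
          simp only [mul_pow, div_pow, pow_succ]
          field_simp
          ring
      _ ≤ _ := mul_le_of_le_one_left (by positivity) (by norm_num)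
  · have hs : 0 < ‖y - η‖ := norm_pos_iff.2 (sub_ne_zero.2 hne)
    have g1' := g1 η
    have g2' := g2 η
    rcases lt_or_ge ‖y - η‖ (‖y‖ / 2) with h | h
    · beta_reduce
      rw [indicator_of_mem (s := Iio (‖y‖ / 2)) (by exact h)]
      have h4 : ‖y‖ ≤ 4 * lam := by linarith [norm_sub_norm_le y η]
      have h5 : 1 ≤ (4 * lam / ‖y‖) ^ n := one_le_pow₀ ((one_le_div hy0).2 h4)
      calc _ ≤ ‖y - η‖ ^ (-((n : ℝ) - 2)) * (2 * lam * (4 * lam / ‖y‖) ^ n) := by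
            gcongr
            exact hη.trans (le_mul_of_one_le_right (by positivity) h5)
        _ ≤ _ := by
          rw [mul_comm]
          exact le_add_of_nonneg_left (by positivity)
    · beta_reduce
      rw [indicator_of_mem (s := closedBall (0 : Euc n) (2 * lam)) (by simpa using hη)]
      have h5 : ‖y - η‖ ^ (-((n : ℝ) - 2)) ≤ (‖y‖ / 2) ^ (-((n : ℝ) - 2)) :=
        Real.rpow_le_rpow_of_nonpos (by positivity) h (by linarith)
      calc _ ≤ (‖y‖ / 2) ^ (-((n : ℝ) - 2)) * (2 * lam) := by gcongr
        _ = 2 * lam * (‖y‖ / 2) ^ (-((n : ℝ) - 2)) * 1 := by ring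
        _ ≤ _ := le_add_of_nonneg_right (by positivity)

/-- A function dominated almost everywhere on `s` is integrable there, with the expected bound. -/
lemma integrableOn_and_abs_setIntegral_le {α : Type*} [MeasurableSpace α] {μ : Measure α}
    {s : Set α} {f F : α → ℝ} {B : ℝ} (hf : AEStronglyMeasurable f (μ.restrict s))
    (hF : Integrable F μ) (hF0 : ∀ x, 0 ≤ F x) (hFB : ∫ x, F x ∂μ ≤ B)
    (h : ∀ᵐ x ∂μ.restrict s, |f x| ≤ F x) :
    IntegrableOn f s μ ∧ |∫ x in s, f x ∂μ| ≤ B := by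
  refine ⟨Integrable.mono' hF.integrableOn hf h, ?_⟩
  calc |∫ x in s, f x ∂μ| ≤ ∫ x in s, F x ∂μ := 
        norm_integral_le_of_norm_le (f := f) hF.integrableOn h
    _ ≤ ∫ x, F x ∂μ := setIntegral_le_integral hF (.of_forall hF0)
    _ ≤ B := hFB

lemma isOpen_sigSet (n : ℕ) (h0 : 0 < n) (lam ρ T : ℝ) : IsOpen (SigSet n h0 lam ρ T) := by
  refine (isOpen_ball.inter (isOpen_lt continuous_const ?_)).sdiff isClosed_closedBall
  fun_prop

lemma measurableSet_omegaSet (n : ℕ) (h0 : 0 < n) (lam ρ T : ℝ) :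
    MeasurableSet (OmegaSet n h0 lam ρ T) := by
  have h1 : IsClosed {y : Euc n | ‖y‖ ≤ 2 * lam} := isClosed_le continuous_norm continuous_const
  have h2 : IsOpen {y : Euc n | 2 * tailNorm n h0 y < y (⟨0, h0⟩ : Fin n)} := by
    refine isOpen_lt ?_ ?_
    · unfold tailNorm; fun_prop
    · fun_prop
  exact (isOpen_sigSet n h0 lam ρ T).measurableSet.inter (h1.measurableSet.inter h2.measurableSet)

lemma measurable_greenG (n : ℕ) (lam : ℝ) (y : Euc n) : Measurable (greenG n lam y) := by
  unfold greenG; fun_prop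

lemma tailNorm_le {n : ℕ} (h0 : 0 < n) (a : ℝ) (y : Euc n) :
    tailNorm n h0 y ≤ ‖y - a • EuclideanSpace.single (⟨0, h0⟩ : Fin n) (1 : ℝ)‖ := by
  rw [tailNorm, EuclideanSpace.norm_eq]
  refine Real.sqrt_le_sqrt ?_
  calc _ = ∑ i ∈ Finset.univ.erase (⟨0, h0⟩ : Fin n),
        ‖(y - a • EuclideanSpace.single (⟨0, h0⟩ : Fin n) (1 : ℝ)) i‖ ^ 2 := by
        refine Finset.sum_congr rfl fun i hi ↦ ?_
        simp [(Finset.mem_erase.1 hi).1]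
    _ ≤ _ := Finset.sum_le_sum_of_subset_of_nonneg (Finset.erase_subset _ _)
        fun _ _ _ ↦ by positivity

/-- A cone around the first coordinate axis, on the upper side of the last coordinate. -/
def axisCone (n : ℕ) (h0 : 0 < n) : Set (Euc n) :=
  {x | ‖x‖ / 2 < x (⟨0, h0⟩ : Fin n) ∧ 0 < x (lastIdx n h0)}

lemma isOpen_axisCone (n : ℕ) (h0 : 0 < n) : IsOpen (axisCone n h0) := by
  have h1 : IsOpen {x : Euc n | ‖x‖ / 2 < x (⟨0, h0⟩ : Fin n)} :=
    isOpen_lt (by fun_prop) (by fun_prop)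
  have h2 : IsOpen {x : Euc n | 0 < x (lastIdx n h0)} := isOpen_lt (by fun_prop) (by fun_prop)
  exact h1.inter h2

lemma smul_mem_axisCone {n : ℕ} (h0 : 0 < n) (t : ℝ) (ht : 0 < t) (x : Euc n)
    (hx : x ∈ axisCone n h0) : t • x ∈ axisCone n h0 := by
  refine ⟨?_, ?_⟩
  · rw [norm_smul, Real.norm_of_nonneg ht.le, PiLp.smul_apply, smul_eq_mul, mul_div_assoc]
    exact mul_lt_mul_of_pos_left hx.1 ht
  · rw [PiLp.smul_apply, smul_eq_mul]
    exact mul_pos ht hx.2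

lemma exists_mem_axisCone {n : ℕ} (hn : 2 ≤ n) (h0 : 0 < n) :
    ∃ x ∈ axisCone n h0, x ≠ 0 := by
  have hne : (⟨0, h0⟩ : Fin n) ≠ lastIdx n h0 := by
    simp only [lastIdx, ne_eq, Fin.mk.injEq]; omega
  set x : Euc n := (2 : ℝ) • EuclideanSpace.single (⟨0, h0⟩ : Fin n) (1 : ℝ) +
    EuclideanSpace.single (lastIdx n h0) (1 : ℝ) with hx
  have h1 : x (⟨0, h0⟩ : Fin n) = 2 := by simp [hx, hne]
  have h2 : x (lastIdx n h0) = 1 := by simp [hx, hne.symm]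
  have h3 : ‖x‖ ≤ 3 := by
    refine (norm_add_le _ _).trans ?_
    rw [norm_smul]
    simp
    norm_num
  refine ⟨x, ⟨by rw [h1]; linarith, by rw [h2]; norm_num⟩, fun h ↦ ?_⟩
  simp [h] at h1

lemma mem_omegaSet_of_sub_mem {n : ℕ} (hn : 2 ≤ n) (h0 : 0 < n) {lam ρ T : ℝ} (hl : 0 < lam)
    (hρ : 4 * lam ≤ ρ) (hT : 0 < T) {η : Euc n}
    (hη : η - lam • EuclideanSpace.single (⟨0, h0⟩ : Fin n) (1 : ℝ) ∈
      coneShell (axisCone n h0) 1 (lam / 8)) :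
    η ∈ OmegaSet n h0 lam ρ T ∧
      ‖η - lam • EuclideanSpace.single (⟨0, h0⟩ : Fin n) (1 : ℝ)‖ / 2 ≤ ‖η‖ - lam := by
  obtain ⟨⟨h1, h2⟩, h3, h4⟩ := hη
  have hne : (⟨0, h0⟩ : Fin n) ≠ lastIdx n h0 := by
    simp only [lastIdx, ne_eq, Fin.mk.injEq]; omega
  have h5 := tailNorm_le h0 lam η
  set e : Euc n := EuclideanSpace.single (⟨0, h0⟩ : Fin n) (1 : ℝ) with he
  have h6 : (η - lam • e) (⟨0, h0⟩ : Fin n) = η (⟨0, h0⟩ : Fin n) - lam := by simp [he]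
  have h7 : (η - lam • e) (lastIdx n h0) = η (lastIdx n h0) := by simp [he, hne.symm]
  rw [h6] at h1
  rw [h7] at h2
  have h8 : η (⟨0, h0⟩ : Fin n) ≤ ‖η‖ :=
    (le_abs_self _).trans (PiLp.norm_apply_le η (⟨0, h0⟩ : Fin n))
  have h9 : ‖η‖ ≤ lam / 8 + lam := by
    have : ‖lam • e‖ = lam := by rw [norm_smul, he]; simp [hl.le]
    have := norm_sub_norm_le η (lam • e)
    linarith
  refine ⟨⟨⟨⟨?_, ?_⟩, ?_⟩, ?_, ?_⟩, ?_⟩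
  · rw [mem_ball_zero_iff]; linarith
  · change -T < η (lastIdx n h0); linarith
  · rw [mem_closedBall_zero_iff, not_le]; linarith
  · linarith
  · linarith
  · linarith

lemma ae_ne_euc {n : ℕ} (h0 : 0 < n) (y : Euc n) : ∀ᵐ η, y ≠ η := by
  have : Nonempty (Fin n) := ⟨⟨0, h0⟩⟩
  simpa only [ne_comm] using Measure.ae_ne volume y

/-- Lower bound for the weight of the source term on the shifted cone. -/
lemma le_sq_mul_rpow (n : ℕ) {r d : ℝ} (hr : 1 ≤ r) (hd : r / 2 ≤ d) :
    (2 ^ (n + 4))⁻¹ * (r ^ n)⁻¹ ≤ d ^ 2 * (1 + r ^ 2) ^ (-(((n : ℝ) + 2) / 2)) := by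
  have hr0 : 0 < r := by linarith
  have h1 : ((2 * r) ^ (n + 2))⁻¹ ≤ (1 + r ^ 2) ^ (-(((n : ℝ) + 2) / 2)) := by
    have h2 : ((2 * r) ^ 2) ^ (-(((n : ℝ) + 2) / 2)) = ((2 * r) ^ (n + 2))⁻¹ := by
      rw [← Real.rpow_natCast, ← Real.rpow_mul (by positivity), ← Real.rpow_natCast,
        ← Real.rpow_neg (by positivity)]
      congr 1; push_cast; ring
    rw [← h2]
    exact Real.rpow_le_rpow_of_nonpos (by positivity) (by nlinarith)
      (by have : (0 : ℝ) ≤ n := n.cast_nonneg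
          linarith)
  calc _ = (r / 2) ^ 2 * ((2 * r) ^ (n + 2))⁻¹ := by
        field_simp; ring
    _ ≤ _ := by gcongr

/-- The logarithmic upper bound for the Green potential of the source on `Ω_λ`. -/
lemma exists_setIntegral_omegaSet_le {n : ℕ} (hn : 4 ≤ n) (h0 : 0 < n) :
    ∃ c : ℝ, 0 < c ∧ ∀ {a lam Γ ρ T : ℝ}, 0 < a → 4096 ≤ lam → 1 ≤ Γ → 0 < T → 4 * lam ≤ ρ →
      ∀ {Q : Euc n → ℝ}, (∀ η ∈ OmegaSet n h0 lam ρ T,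
          Q η ≤ -a * Γ⁻¹ * (‖η‖ - lam)
            * (1 + ‖η - lam • EuclideanSpace.single (⟨0, h0⟩ : Fin n) (1 : ℝ)‖ ^ 2)
              ^ (-(((n : ℝ) + 2) / 2))) →
      ∀ {y : Euc n}, lam < ‖y‖ →
        IntegrableOn (fun η ↦ greenG n lam y η * Q η) (OmegaSet n h0 lam ρ T) →
        ∫ η in OmegaSet n h0 lam ρ T, greenG n lam y η * Q η ≤
          -(c * a * (Γ⁻¹ * (min 1 ((‖y‖ - lam) / lam) * ‖y‖ ^ (-((n : ℝ) - 2)) * lam⁻¹)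
            * Real.log lam)) := by
  have hS := sphereArea_pos h0
  obtain ⟨x₀, hx₀, hx₀'⟩ := exists_mem_axisCone (by omega : 2 ≤ n) h0
  obtain ⟨c, hc, hlog⟩ := exists_log_le_integral_coneShell (isOpen_axisCone n h0)
    (smul_mem_axisCone h0) hx₀ hx₀'
  refine ⟨1 / (2 * sphereArea n) * (3 : ℝ) ^ (-(n : ℝ)) * (2 ^ (n + 4))⁻¹ * c, by positivity, ?_⟩
  intro a lam Γ ρ T ha hlam hΓ hT hρ Q hQ y hy hint
  have hl : 0 < lam := by linarith
  set e : Euc n := EuclideanSpace.single (⟨0, h0⟩ : Fin n) (1 : ℝ)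
  set κ := min 1 ((‖y‖ - lam) / lam) * ‖y‖ ^ (-((n : ℝ) - 2)) * lam⁻¹ with hκ
  have hκ0 : 0 ≤ κ := by
    have : 0 ≤ min 1 ((‖y‖ - lam) / lam) :=
      le_min zero_le_one (div_nonneg (by linarith) hl.le)
    positivity
  set W := coneShell (axisCone n h0) 1 (lam / 8)
  have hWm : MeasurableSet W := measurableSet_coneShell (isOpen_axisCone n h0).measurableSet _ _
  set W' := (fun η ↦ η - lam • e) ⁻¹' W
  have hmp := measurePreserving_sub_right (volume : Measure (Euc n)) (lam • e)
  have hemb : MeasurableEmbedding (fun η : Euc n ↦ η - lam • e) :=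
    (Homeomorph.subRight (lam • e)).measurableEmbedding
  have hW'm : MeasurableSet W' := hmp.measurable hWm
  have hsub : W' ⊆ OmegaSet n h0 lam ρ T := fun η hη ↦
    (mem_omegaSet_of_sub_mem (by omega) h0 hl hρ hT hη).1
  set b := 1 / (2 * sphereArea n) * (3 : ℝ) ^ (-(n : ℝ)) * κ * (a * Γ⁻¹) * (2 ^ (n + 4))⁻¹ with hb
  have hb0 : 0 ≤ b := by positivity
  have hint' : IntegrableOn (fun η ↦ -(b * (‖η - lam • e‖ ^ n)⁻¹)) W' := by
    have := (hmp.integrableOn_comp_preimage hemb (f := fun x ↦ (‖x‖ ^ n)⁻¹) (s := W)).2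
      (integrableOn_coneShell (isOpen_axisCone n h0).measurableSet one_pos _)
    exact (this.const_mul b).neg
  have hne := ae_ne_euc h0 y
  calc ∫ η in OmegaSet n h0 lam ρ T, greenG n lam y η * Q η
      ≤ ∫ η in OmegaSet n h0 lam ρ T, W'.indicator (fun η ↦ -(b * (‖η - lam • e‖ ^ n)⁻¹)) η := by
        refine setIntegral_mono_on_ae hint ((integrable_indicator_iff hW'm).2 hint').integrableOn
          (measurableSet_omegaSet n h0 lam ρ T) ?_
        filter_upwards [hne] with η hηy hη
        have hηl : lam < ‖η‖ := by simpa using hη.1.2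
        have hd : 0 < ‖η‖ - lam := by linarith
        have hQη := hQ η hη
        have hG := le_greenG (by omega) hl hy hηl hηy hη.2.1
        have hw : 0 ≤ (1 + ‖η - lam • e‖ ^ 2) ^ (-(((n : ℝ) + 2) / 2)) := by positivity
        have hG0 := greenG_nonneg (by omega) hl hy hηl hηy
        by_cases hηW : η ∈ W'
        · rw [indicator_of_mem hηW]
          have h1 := le_sq_mul_rpow n hηW.2.1
            (mem_omegaSet_of_sub_mem (by omega) h0 hl hρ hT hηW).2
          have h2 : 0 ≤ a * Γ⁻¹ * (‖η‖ - lam) *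
              (1 + ‖η - lam • e‖ ^ 2) ^ (-(((n : ℝ) + 2) / 2)) := by positivity
          calc greenG n lam y η * Q η
              ≤ greenG n lam y η * -(a * Γ⁻¹ * (‖η‖ - lam) *
                (1 + ‖η - lam • e‖ ^ 2) ^ (-(((n : ℝ) + 2) / 2))) := by
                refine mul_le_mul_of_nonneg_left (hQη.trans_eq ?_) hG0
                ring
            _ ≤ -(1 / (2 * sphereArea n) * (3 : ℝ) ^ (-(n : ℝ)) * κ * (‖η‖ - lam) *
                (a * Γ⁻¹ * (‖η‖ - lam) *
                (1 + ‖η - lam • e‖ ^ 2) ^ (-(((n : ℝ) + 2) / 2)))) := by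
                rw [mul_neg, neg_le_neg_iff]
                refine mul_le_mul_of_nonneg_right (le_of_eq_of_le ?_ hG) h2
                rw [hκ]; ring
            _ = -(1 / (2 * sphereArea n) * (3 : ℝ) ^ (-(n : ℝ)) * κ * (a * Γ⁻¹) *
                ((‖η‖ - lam) ^ 2 * (1 + ‖η - lam • e‖ ^ 2) ^ (-(((n : ℝ) + 2) / 2)))) := by
                ring
            _ ≤ -(1 / (2 * sphereArea n) * (3 : ℝ) ^ (-(n : ℝ)) * κ * (a * Γ⁻¹) *
                ((2 ^ (n + 4))⁻¹ * (‖η - lam • e‖ ^ n)⁻¹)) := by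
                rw [neg_le_neg_iff]
                exact mul_le_mul_of_nonneg_left h1 (by positivity)
            _ = _ := by rw [hb]; ring
        · rw [indicator_of_notMem hηW]
          refine mul_nonpos_of_nonneg_of_nonpos hG0 (hQη.trans ?_)
          have : 0 ≤ a * Γ⁻¹ * (‖η‖ - lam) *
              (1 + ‖η - lam • e‖ ^ 2) ^ (-(((n : ℝ) + 2) / 2)) := by positivity
          linarith
    _ = -(b * ∫ x in W, (‖x‖ ^ n)⁻¹) := by
        rw [setIntegral_indicator hW'm, inter_eq_right.2 hsub, integral_neg, integral_const_mul,
          ← hmp.setIntegral_preimage_emb hemb (fun x ↦ (‖x‖ ^ n)⁻¹) W]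
    _ ≤ -(b * (c * Real.log lam)) := by
        rw [neg_le_neg_iff]
        exact mul_le_mul_of_nonneg_left (hlog lam hlam) hb0
    _ = _ := by rw [hb]; ring

/-- The estimates for the Green potential with a unified weight in place of the two ranges. -/
lemma exists_green_potential_le {n : ℕ} (hn : 4 ≤ n) (h0 : 0 < n) :
    ∃ c : ℝ, 0 < c ∧ ∀ {a₁ a₂ lam Γ ρ T : ℝ}, 0 < a₁ → 0 < a₂ → 4096 ≤ lam → 1 ≤ Γ → 0 < T →
      4 * lam ≤ ρ → ∀ {Q : Euc n → ℝ}, ContinuousOn Q (SigSet n h0 lam ρ T) →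
        (∀ η ∈ OmegaSet n h0 lam ρ T,
          Q η ≤ -a₁ * Γ⁻¹ * (‖η‖ - lam)
            * (1 + ‖η - lam • EuclideanSpace.single (⟨0, h0⟩ : Fin n) (1 : ℝ)‖ ^ 2)
              ^ (-(((n : ℝ) + 2) / 2))) →
        (∀ η ∈ OmegaSet n h0 lam ρ T, |Q η| ≤ a₂ * Γ⁻¹ * (‖η‖ - lam)) →
        (∀ η ∈ SigSet n h0 lam ρ T \ OmegaSet n h0 lam ρ T,
          |Q η| ≤ a₂ * Γ⁻¹ * (‖η‖ - lam) * ‖η‖ ^ (-(n : ℝ) - 2)) →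
      ∀ {y : Euc n}, lam < ‖y‖ →
        ∫ η in SigSet n h0 lam ρ T, greenG n lam y η * Q η ≤
          Γ⁻¹ * (min 1 ((‖y‖ - lam) / lam) * ‖y‖ ^ (-((n : ℝ) - 2))) * lam⁻¹ *
            (12 * 2 ^ n * a₂ - c * a₁ * Real.log lam) ∧
        |∫ η in SigSet n h0 lam ρ T, greenG n lam y η * Q η| ≤
          24 * 4 ^ n * a₂ * (Γ⁻¹ * (min 1 ((‖y‖ - lam) / lam) * ‖y‖ ^ (-((n : ℝ) - 2))) *
            lam ^ (n + 1)) := by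
  have hS := sphereArea_pos h0
  obtain ⟨c, hc, hO⟩ := exists_setIntegral_omegaSet_le hn h0
  refine ⟨c, hc, ?_⟩
  intro a₁ a₂ lam Γ ρ T ha₁ ha₂ hlam hΓ hT hρ Q hQc hQ1 hQ2 hQ3 y hy
  have hl : 0 < lam := by linarith
  have hy0 : 0 < ‖y‖ := by linarith
  set m := min 1 ((‖y‖ - lam) / lam)
  have hm0 : 0 ≤ m := le_min zero_le_one (div_nonneg (by linarith) hl.le)
  set S := SigSet n h0 lam ρ T
  set O := OmegaSet n h0 lam ρ T
  have hOS : O ⊆ S := fun η hη ↦ hη.1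
  have hSm : MeasurableSet S := (isOpen_sigSet n h0 lam ρ T).measurableSet
  have hOmeas : MeasurableSet O := measurableSet_omegaSet n h0 lam ρ T
  have hmeas : AEStronglyMeasurable (fun η ↦ greenG n lam y η * Q η) (volume.restrict S) :=
    (measurable_greenG n lam y).aestronglyMeasurable.mul (hQc.aestronglyMeasurable hSm)
  have hne := ae_ne_euc h0 y
  set A := 12 / sphereArea n * m * (a₂ * Γ⁻¹) with hA
  have hA0 : 0 ≤ A := by positivity
  have habs : ∀ η ∈ S, y ≠ η → ∀ w : ℝ, 0 ≤ w → |Q η| ≤ a₂ * Γ⁻¹ * (‖η‖ - lam) * w →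
      |greenG n lam y η * Q η| ≤ A * (‖y - η‖ ^ (-((n : ℝ) - 2)) * (‖η‖ * w)) := by
    intro η hη hηy w hw hQw
    have hηl : lam < ‖η‖ := by simpa using hη.2
    have hG0 := greenG_nonneg (by omega) hl hy hηl hηy
    have hGm := greenG_mul_le (by omega) hl hy hηl hηy
    rw [abs_mul, abs_of_nonneg hG0]
    calc _ ≤ greenG n lam y η * (a₂ * Γ⁻¹ * (‖η‖ - lam) * w) := by gcongr
      _ = (greenG n lam y η * (‖η‖ - lam)) * (a₂ * Γ⁻¹ * w) := by ring
      _ ≤ (12 / sphereArea n * m * ‖y - η‖ ^ (-((n : ℝ) - 2)) * ‖η‖) * (a₂ * Γ⁻¹ * w) := by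
        gcongr
      _ = _ := by rw [hA]; ring
  obtain ⟨F, hF, hF0, hFi, hFle⟩ := exists_majorant_far (by omega : 3 ≤ n) hl hy
  obtain ⟨F', hF', hF0', hFi', hFle'⟩ := exists_majorant_near (by omega : 3 ≤ n) hl hy
  obtain ⟨intT, hT'⟩ := integrableOn_and_abs_setIntegral_le (s := S \ O)
    (B := A * (2 ^ n * sphereArea n * (‖y‖ ^ (-((n : ℝ) - 2)) * lam⁻¹)))
    (hmeas.mono_measure (Measure.restrict_mono sdiff_subset le_rfl)) (hF.const_mul A)
    (fun x ↦ mul_nonneg hA0 (hF0 x))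
    (by rw [integral_const_mul]; exact mul_le_mul_of_nonneg_left hFi hA0) (by
      filter_upwards [ae_restrict_mem (hSm.diff hOmeas), ae_restrict_of_ae hne] with η hη hηy
      have hηl : lam < ‖η‖ := by simpa using hη.1.2
      have hη0 : 0 < ‖η‖ := hl.trans hηl
      refine (habs η hη.1 hηy _ (by positivity) (hQ3 η hη)).trans ?_
      refine mul_le_mul_of_nonneg_left (le_of_eq_of_le ?_ (hFle η hηl hηy)) hA0
      rw [← Real.rpow_one_add' hη0.le (by have : (0 : ℝ) ≤ n := n.cast_nonneg
                                          linarith)]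
      congr 2; ring)
  obtain ⟨intO, hO'⟩ := integrableOn_and_abs_setIntegral_le (s := O)
    (B := A * (4 ^ n * sphereArea n * (‖y‖ ^ (-((n : ℝ) - 2)) * lam ^ (n + 1))))
    (hmeas.mono_measure (Measure.restrict_mono hOS le_rfl)) (hF'.const_mul A)
    (fun x ↦ mul_nonneg hA0 (hF0' x))
    (by rw [integral_const_mul]; exact mul_le_mul_of_nonneg_left hFi' hA0) (by
      filter_upwards [ae_restrict_mem hOmeas, ae_restrict_of_ae hne] with η hη hηy
      refine (habs η hη.1 hηy 1 zero_le_one (by simpa using hQ2 η hη)).trans ?_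
      rw [mul_one]
      exact mul_le_mul_of_nonneg_left (hFle' η hη.2.1 hηy) hA0)
  have hsplit : ∫ η in S, greenG n lam y η * Q η = (∫ η in O, greenG n lam y η * Q η) +
      ∫ η in S \ O, greenG n lam y η * Q η := by
    rw [← setIntegral_union disjoint_sdiff_right (hSm.diff hOmeas) intO intT,
      union_sdiff_cancel hOS]
  have hOneg := hO ha₁ hlam hΓ hT hρ hQ1 hy intO
  have eT : A * (2 ^ n * sphereArea n * (‖y‖ ^ (-((n : ℝ) - 2)) * lam⁻¹)) =
      Γ⁻¹ * (m * ‖y‖ ^ (-((n : ℝ) - 2))) * lam⁻¹ * (12 * 2 ^ n * a₂) := by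
    rw [hA]; field_simp
  have eO : A * (4 ^ n * sphereArea n * (‖y‖ ^ (-((n : ℝ) - 2)) * lam ^ (n + 1))) =
      Γ⁻¹ * (m * ‖y‖ ^ (-((n : ℝ) - 2))) * (12 * 4 ^ n * a₂) * lam ^ (n + 1) := by
    rw [hA]; field_simp
  rw [eT] at hT'
  rw [eO] at hO'
  rw [hsplit]
  constructor
  · have := (abs_le.1 hT').2
    linarith
  · refine (abs_add_le _ _).trans ((add_le_add hO' hT').trans ?_)
    have h1 : lam⁻¹ ≤ lam ^ (n + 1) :=
      (inv_le_one_of_one_le₀ (by linarith)).trans (one_le_pow₀ (by linarith))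
    have h2 : (2 : ℝ) ^ n ≤ 4 ^ n := by gcongr; norm_num
    calc _ ≤ Γ⁻¹ * (m * ‖y‖ ^ (-((n : ℝ) - 2))) * (12 * 4 ^ n * a₂) * lam ^ (n + 1) +
          Γ⁻¹ * (m * ‖y‖ ^ (-((n : ℝ) - 2))) * lam ^ (n + 1) * (12 * 4 ^ n * a₂) := by gcongr
      _ = _ := by ring

/-- estimates for the Green potential `h(y) = ∫_{Σ_λ} G_λ(y,η) Q(η) dη`. -/
theorem green_potential_estimates (n : ℕ) (hn : 4 ≤ n) (h0 : 0 < n)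
    (a₁ a₂ : ℝ) (ha₁ : 0 < a₁) (ha₂ : 0 < a₂) :
    ∃ R₀ : ℝ, 8 ≤ R₀ ∧ ∃ C₁ : ℝ, 0 < C₁ ∧ ∃ C₂ : ℝ, 0 < C₂ ∧
      ∀ R : ℝ, R₀ ≤ R → ∀ lam ∈ Set.Icc R (R + 2),
      ∀ Γ : ℝ, 1 ≤ Γ → ∀ T : ℝ, 0 < T → ∀ ρ : ℝ, 4 * lam ≤ ρ → ρ ≤ Γ →
      ∀ Q : Euc n → ℝ,
        ContinuousOn Q (SigSet n h0 lam ρ T) →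
        (∀ η ∈ OmegaSet n h0 lam ρ T,
          Q η ≤ -a₁ * Γ⁻¹ * (‖η‖ - lam)
            * (1 + ‖η - lam • EuclideanSpace.single (⟨0, h0⟩ : Fin n) (1 : ℝ)‖ ^ 2)
              ^ (-(((n : ℝ) + 2) / 2))) →
        (∀ η ∈ OmegaSet n h0 lam ρ T, |Q η| ≤ a₂ * Γ⁻¹ * (‖η‖ - lam)) →
        (∀ η ∈ SigSet n h0 lam ρ T \ OmegaSet n h0 lam ρ T,
          |Q η| ≤ a₂ * Γ⁻¹ * (‖η‖ - lam) * ‖η‖ ^ (-(n : ℝ) - 2)) →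
        ∀ y ∈ SigSet n h0 lam ρ T,
          (‖y‖ ≤ 4 * lam →
            (∫ η in SigSet n h0 lam ρ T, greenG n lam y η * Q η)
                ≤ -C₁ * Γ⁻¹ * (‖y‖ - lam) * lam ^ (-(n : ℝ)) * Real.log lam ∧
            |∫ η in SigSet n h0 lam ρ T, greenG n lam y η * Q η|
                ≤ C₂ * Γ⁻¹ * (‖y‖ - lam) * lam ^ 2) ∧
          (4 * lam ≤ ‖y‖ →
            (∫ η in SigSet n h0 lam ρ T, greenG n lam y η * Q η)
                ≤ -C₁ * Γ⁻¹ * ‖y‖ ^ ((2 : ℝ) - (n : ℝ)) * lam⁻¹ * Real.log lam ∧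
            |∫ η in SigSet n h0 lam ρ T, greenG n lam y η * Q η|
                ≤ C₂ * Γ⁻¹ * ‖y‖ ^ ((2 : ℝ) - (n : ℝ)) * lam ^ ((n : ℝ) + 1)) := by
  obtain ⟨c, hc, hmain⟩ := exists_green_potential_le hn h0
  refine ⟨max 4096 (Real.exp (24 * 2 ^ n * a₂ / (c * a₁))), le_max_of_le_left (by norm_num),
    c * a₁ / 2 * ((4 : ℝ) ^ (-((n : ℝ) - 2)) / 3), by positivity,
    24 * 4 ^ n * a₂, by positivity, ?_⟩
  intro R hR lam hlam Γ hΓ T hT ρ hρ _ Q hQc hQ1 hQ2 hQ3 y hyS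
  have hn' : (4 : ℝ) ≤ n := by exact_mod_cast hn
  have hlam' : 4096 ≤ lam := (le_max_left _ _).trans (hR.trans hlam.1)
  have hl : 0 < lam := by linarith
  have hy : lam < ‖y‖ := by simpa using hyS.2
  have hy0 : 0 < ‖y‖ := hl.trans hy
  have hΓ0 : 0 < Γ⁻¹ := by positivity
  have hlog : 24 * 2 ^ n * a₂ / (c * a₁) ≤ Real.log lam :=
    (Real.le_log_iff_exp_le hl).2 ((le_max_right _ _).trans (hR.trans hlam.1))
  have hlog0 : 0 ≤ Real.log lam := Real.log_nonneg (by linarith)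
  rw [div_le_iff₀ (by positivity)] at hlog
  obtain ⟨hneg, habs⟩ := hmain ha₁ ha₂ hlam' hΓ hT hρ hQc hQ1 hQ2 hQ3 hy
  rw [neg_sub] at hneg habs ⊢
  set I := ∫ η in SigSet n h0 lam ρ T, greenG n lam y η * Q η
  set m := min 1 ((‖y‖ - lam) / lam) with hm
  have hm0 : 0 ≤ m := le_min zero_le_one (div_nonneg (by linarith) hl.le)
  have hneg' : I ≤ -(c * a₁ / 2 * (Γ⁻¹ * (m * ‖y‖ ^ ((2 : ℝ) - n)) * lam⁻¹ * Real.log lam)) := by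
    refine hneg.trans ?_
    calc _ ≤ Γ⁻¹ * (m * ‖y‖ ^ ((2 : ℝ) - n)) * lam⁻¹ * -(c * a₁ / 2 * Real.log lam) := by
          gcongr; linarith
      _ = _ := by ring
  have h4 : (4 : ℝ) ^ ((2 : ℝ) - n) ≤ 1 :=
    Real.rpow_le_one_of_one_le_of_nonpos (by norm_num) (by linarith)
  have h40 : 0 < (4 : ℝ) ^ ((2 : ℝ) - n) := by positivity
  have hpow : lam ^ (n + 1) = lam ^ ((n : ℝ) + 1) := by
    rw [← Real.rpow_natCast]; push_cast; rfl
  refine ⟨fun hle ↦ ⟨?_, ?_⟩, fun hge ↦ ⟨?_, ?_⟩⟩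
  · have h1 : (‖y‖ - lam) / (3 * lam) ≤ m := by
      refine le_min ((div_le_one (by positivity)).2 (by linarith)) ?_
      have : 0 < ‖y‖ - lam := by linarith
      gcongr
      linarith
    have h2 : (4 * lam) ^ ((2 : ℝ) - n) ≤ ‖y‖ ^ ((2 : ℝ) - n) :=
      Real.rpow_le_rpow_of_nonpos hy0 hle (by linarith)
    have h3 : lam ^ (-(n : ℝ)) = lam ^ ((2 : ℝ) - n) / lam ^ 2 := by
      rw [← Real.rpow_natCast lam 2, ← Real.rpow_sub hl]; congr 1; push_cast; ring
    refine hneg'.trans ?_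
    calc _ ≤ -(c * a₁ / 2 * (Γ⁻¹ * ((‖y‖ - lam) / (3 * lam) * (4 * lam) ^ ((2 : ℝ) - n)) * lam⁻¹ *
          Real.log lam)) := by
          rw [neg_le_neg_iff]
          gcongr
      _ = _ := by
          rw [h3, Real.mul_rpow (by norm_num) hl.le]
          field_simp
  · have h1 : m ≤ (‖y‖ - lam) / lam := min_le_right _ _
    have h2 : ‖y‖ ^ ((2 : ℝ) - n) ≤ lam ^ ((2 : ℝ) - n) :=
      Real.rpow_le_rpow_of_nonpos hl hy.le (by linarith)
    have h3 : lam ^ ((2 : ℝ) - n) * lam ^ (n + 1) = lam ^ 3 := by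
      rw [← Real.rpow_natCast, ← Real.rpow_natCast, ← Real.rpow_add hl]
      congr 1; push_cast; ring
    have h5 : 0 ≤ (‖y‖ - lam) / lam := div_nonneg (by linarith) hl.le
    refine habs.trans ?_
    calc _ ≤ 24 * 4 ^ n * a₂ * (Γ⁻¹ * ((‖y‖ - lam) / lam * lam ^ ((2 : ℝ) - n)) *
          lam ^ (n + 1)) := by gcongr
      _ = 24 * 4 ^ n * a₂ * (Γ⁻¹ * ((‖y‖ - lam) / lam) *
          (lam ^ ((2 : ℝ) - n) * lam ^ (n + 1))) := by ring
      _ = _ := by rw [h3]; field_simp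
  all_goals
    have h1 : m = 1 := min_eq_left ((one_le_div hl).2 (by linarith))
    rw [h1, one_mul] at hneg' habs
  · refine hneg'.trans ?_
    have h2 : 0 ≤ c * a₁ / 2 * (Γ⁻¹ * ‖y‖ ^ ((2 : ℝ) - n) * lam⁻¹ * Real.log lam) := by positivity
    nlinarith
  · refine habs.trans_eq ?_
    rw [hpow]; ring
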